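/- Let θ ∈ (π, 2π) be fixed. Then for all x, y ∈ S_θ, the inequality s_{S_θ}(x,y) ≤ √2·sin(θ/4)·p_{S_θ}(x,y) holds. -/

import Mathlib

open Set Metric Complex

/-- The open sector of angle `θ`: points with polar angle strictly between `0` and `θ`. -/
noncomputable def sector (θ : ℝ) : Set ℂ :=
  {z : ℂ | ∃ r φ : ℝ, 0 < r ∧ 0 < φ ∧ φ < θ ∧ z = r * Complex.exp (φ * Complex.I)}

/-- Distance from `x` to the boundary of `G`. -/
noncomputable def distBd (G : Set ℂ) (x : ℂ) : ℝ :=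
  Metric.infDist x (frontier G)

/-- The triangular ratio metric `s_G`. -/
noncomputable def triRatio (G : Set ℂ) (x y : ℂ) : ℝ :=
  dist x y / sInf ((fun z => dist x z + dist z y) '' frontier G)

/-- The `j*`-metric. -/
noncomputable def jStar (G : Set ℂ) (x y : ℂ) : ℝ :=
  dist x y / (dist x y + 2 * min (distBd G x) (distBd G y))

/-- The point pair function `p_G`. -/
noncomputable def pointPair (G : Set ℂ) (x y : ℂ) : ℝ :=
  dist x y / Real.sqrt (dist x y ^ 2 + 4 * distBd G x * distBd G y)

lemma mem_sector_iff {θ : ℝ} (h₁ : Real.pi < θ) (h₂ : θ < 2 * Real.pi) (z : ℂ) :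
    z ∈ sector θ ↔ 0 < z.im ∨ z.im * Real.cos θ - z.re * Real.sin θ < 0 := by
  constructor
  · rintro ⟨r, φ, hr, hφ, hφθ, rfl⟩
    simp only [re_ofReal_mul, im_ofReal_mul, exp_ofReal_mul_I_re, exp_ofReal_mul_I_im]
    rcases lt_or_ge φ Real.pi with h | h
    · exact Or.inl (mul_pos hr (Real.sin_pos_of_pos_of_lt_pi hφ h))
    · right
      have := Real.sin_neg_of_neg_of_neg_pi_lt (x := φ - θ) (by linarith) (by linarith)
      rw [Real.sin_sub] at this
      nlinarith
  · intro hz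
    have hz0 : z ≠ 0 := by rintro rfl; simp at hz
    have hpos : 0 < ‖z‖ := norm_pos_iff.mpr hz0
    obtain ⟨φ, hφ0, hφ2, hφ⟩ : ∃ φ : ℝ, 0 < φ ∧ φ ≤ 2 * Real.pi ∧
        z = ‖z‖ * Complex.exp (φ * Complex.I) := by
      rcases lt_or_ge 0 z.arg with h | h
      · exact ⟨z.arg, h, by linarith [z.arg_le_pi, Real.pi_pos], (norm_mul_exp_arg_mul_I z).symm⟩
      · refine ⟨z.arg + 2 * Real.pi, by linarith [z.neg_pi_lt_arg, Real.pi_pos], by linarith, ?_⟩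
        push_cast
        rw [add_mul, Complex.exp_add, Complex.exp_two_pi_mul_I, mul_one]
        exact (norm_mul_exp_arg_mul_I z).symm
    refine ⟨‖z‖, φ, hpos, hφ0, ?_, hφ⟩
    by_contra! hθφ
    have hre : z.re = ‖z‖ * Real.cos φ := by
      conv_lhs => rw [hφ]
      rw [re_ofReal_mul, exp_ofReal_mul_I_re]
    have him : z.im = ‖z‖ * Real.sin φ := by
      conv_lhs => rw [hφ]
      rw [im_ofReal_mul, exp_ofReal_mul_I_im]
    have hs₁ : Real.sin φ ≤ 0 := by
      have := Real.sin_nonneg_of_nonneg_of_le_pi (x := 2 * Real.pi - φ) (by linarith)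
        (by linarith)
      rw [Real.sin_two_pi_sub] at this
      linarith
    have hs₂ := Real.sin_nonneg_of_nonneg_of_le_pi (x := φ - θ) (by linarith) (by linarith)
    rw [Real.sin_sub] at hs₂
    rw [hre, him] at hz
    rcases hz with h | h <;> nlinarith

lemma isOpen_sector {θ : ℝ} (h₁ : Real.pi < θ) (h₂ : θ < 2 * Real.pi) : IsOpen (sector θ) := by
  have : sector θ = {z : ℂ | 0 < z.im} ∪
      {z : ℂ | z.im * Real.cos θ - z.re * Real.sin θ < 0} :=
    Set.ext fun z => mem_sector_iff h₁ h₂ z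
  rw [this]
  exact (isOpen_lt (by fun_prop) (by fun_prop)).union (isOpen_lt (by fun_prop) (by fun_prop))

lemma add_notMem_sector {θ : ℝ} (h₁ : Real.pi < θ) (h₂ : θ < 2 * Real.pi) {z w : ℂ}
    (hz : z ∉ sector θ) (hw : w ∉ sector θ) : z + w ∉ sector θ := by
  rw [mem_sector_iff h₁ h₂, not_or, not_lt, not_lt] at *
  simp only [add_re, add_im]
  exact ⟨by linarith, by linarith⟩

lemma ofReal_notMem_sector {θ : ℝ} (h₁ : Real.pi < θ) (h₂ : θ < 2 * Real.pi) {t : ℝ}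
    (ht : 0 ≤ t) : (t : ℂ) ∉ sector θ := by
  rw [mem_sector_iff h₁ h₂, not_or, not_lt, not_lt]
  have := Real.sin_neg_of_neg_of_neg_pi_lt (x := θ - 2 * Real.pi) (by linarith) (by linarith)
  rw [Real.sin_sub_two_pi] at this
  simp only [ofReal_re, ofReal_im]
  exact ⟨le_rfl, by nlinarith⟩

lemma ofReal_mul_exp_notMem_sector {θ : ℝ} (h₁ : Real.pi < θ) (h₂ : θ < 2 * Real.pi) {t : ℝ}
    (ht : 0 ≤ t) : (t * Complex.exp (θ * Complex.I) : ℂ) ∉ sector θ := by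
  rw [mem_sector_iff h₁ h₂, not_or, not_lt, not_lt]
  have := Real.sin_neg_of_neg_of_neg_pi_lt (x := θ - 2 * Real.pi) (by linarith) (by linarith)
  rw [Real.sin_sub_two_pi] at this
  simp only [re_ofReal_mul, im_ofReal_mul, exp_ofReal_mul_I_re, exp_ofReal_mul_I_im]
  exact ⟨by nlinarith, by nlinarith⟩

lemma distBd_le_dist {G : Set ℂ} {x w : ℂ} (hx : x ∈ G) (hw : w ∉ G) :
    distBd G x ≤ dist x w := by
  obtain ⟨y, hy, hxy⟩ := exists_mem_frontier_infDist_compl_eq_dist hx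
    (fun h => hw (h ▸ mem_univ w))
  calc distBd G x ≤ dist x y := infDist_le_dist_of_mem hy
    _ = infDist x Gᶜ := hxy.symm
    _ ≤ dist x w := infDist_le_dist_of_mem hw

lemma sq_norm_mul_exp_sub (a b u v : ℝ) :
    ‖(a * Complex.exp (u * Complex.I) - b * Complex.exp (v * Complex.I) : ℂ)‖ ^ 2 =
      a ^ 2 + b ^ 2 - 2 * (a * b) * Real.cos (u - v) := by
  rw [Complex.sq_norm, normSq_apply]
  simp only [sub_re, sub_im, re_ofReal_mul, im_ofReal_mul, exp_ofReal_mul_I_re,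
    exp_ofReal_mul_I_im, Real.cos_sub]
  linear_combination a ^ 2 * Real.sin_sq_add_cos_sq u + b ^ 2 * Real.sin_sq_add_cos_sq v

lemma norm_mul_exp_sub_cos_mul_exp {a u v : ℝ} (ha : 0 ≤ a) (h : 0 ≤ Real.sin (u - v)) :
    ‖(a * Complex.exp (u * Complex.I) -
      (a * Real.cos (u - v) : ℝ) * Complex.exp (v * Complex.I) : ℂ)‖ =
      a * Real.sin (u - v) := by
  rw [← sq_eq_sq₀ (norm_nonneg _) (mul_nonneg ha h), sq_norm_mul_exp_sub]
  linear_combination -a ^ 2 * Real.sin_sq_add_cos_sq (u - v)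

lemma norm_mul_exp_sub_cos_mul_exp' {a u v : ℝ} (ha : 0 ≤ a) (h : 0 ≤ Real.sin (v - u)) :
    ‖(a * Complex.exp (u * Complex.I) -
      (a * Real.cos (v - u) : ℝ) * Complex.exp (v * Complex.I) : ℂ)‖ =
      a * Real.sin (v - u) := by
  rw [← sq_eq_sq₀ (norm_nonneg _) (mul_nonneg ha h), sq_norm_mul_exp_sub, ← neg_sub v u,
    Real.cos_neg]
  linear_combination -a ^ 2 * Real.sin_sq_add_cos_sq (v - u)

lemma distBd_sector_le_sin {θ : ℝ} (h₁ : Real.pi < θ) (h₂ : θ < 2 * Real.pi) {x z : ℂ}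
    (hx : x ∈ sector θ) (hz : z ∉ sector θ) {a u : ℝ} (ha : 0 < a) (hu : 0 < u)
    (hxz : x - z = a * Complex.exp (u * Complex.I)) :
    distBd (sector θ) x ≤ a * Real.sin (min u (Real.pi / 2)) := by
  rcases le_total u (Real.pi / 2) with h | h
  · rw [min_eq_left h]
    have hcos : 0 ≤ Real.cos u := Real.cos_nonneg_of_neg_pi_div_two_le_of_le (by linarith) h
    have hsin : 0 ≤ Real.sin u := Real.sin_nonneg_of_nonneg_of_le_pi hu.le (by linarith)
    have hw := add_notMem_sector h₁ h₂ hz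
      (ofReal_notMem_sector h₁ h₂ (mul_nonneg ha.le hcos))
    have key := norm_mul_exp_sub_cos_mul_exp (u := u) (v := 0) ha.le (by simpa using hsin)
    simp only [sub_zero, ofReal_zero, zero_mul, Complex.exp_zero, mul_one] at key
    refine (distBd_le_dist hx hw).trans_eq ?_
    rw [dist_eq_norm, ← key, ← hxz, sub_add_eq_sub_sub]
  · rw [min_eq_right h, Real.sin_pi_div_two, mul_one]
    refine (distBd_le_dist hx hz).trans_eq ?_
    rw [dist_eq_norm, hxz, norm_mul, norm_exp_ofReal_mul_I, mul_one, norm_real,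
      Real.norm_of_nonneg ha.le]

lemma distBd_sector_le_sin_sub {θ : ℝ} (h₁ : Real.pi < θ) (h₂ : θ < 2 * Real.pi) {x z : ℂ}
    (hx : x ∈ sector θ) (hz : z ∉ sector θ) {a u : ℝ} (ha : 0 < a) (hu : u < θ)
    (hxz : x - z = a * Complex.exp (u * Complex.I)) :
    distBd (sector θ) x ≤ a * Real.sin (min (θ - u) (Real.pi / 2)) := by
  rcases le_total (θ - u) (Real.pi / 2) with h | h
  · rw [min_eq_left h]
    have hcos : 0 ≤ Real.cos (θ - u) :=
      Real.cos_nonneg_of_neg_pi_div_two_le_of_le (by linarith) h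
    have hsin : 0 ≤ Real.sin (θ - u) :=
      Real.sin_nonneg_of_nonneg_of_le_pi (by linarith) (by linarith)
    have hw := add_notMem_sector h₁ h₂ hz
      (ofReal_mul_exp_notMem_sector h₁ h₂ (mul_nonneg ha.le hcos))
    refine (distBd_le_dist hx hw).trans_eq ?_
    rw [dist_eq_norm, ← norm_mul_exp_sub_cos_mul_exp' ha.le hsin, ← hxz, sub_add_eq_sub_sub]
  · rw [min_eq_right h, Real.sin_pi_div_two, mul_one]
    refine (distBd_le_dist hx hz).trans_eq ?_
    rw [dist_eq_norm, hxz, norm_mul, norm_exp_ofReal_mul_I, mul_one, norm_real,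
      Real.norm_of_nonneg ha.le]

lemma two_mul_sin_min_mul_sin_min_le {α s t : ℝ} (hα₁ : Real.pi / 2 < α) (hα₂ : α < Real.pi)
    (hs : 0 < s) (ht : 0 < t) (hst : s + t ≤ 2 * α) :
    2 * (Real.sin (min s (Real.pi / 2)) * Real.sin (min t (Real.pi / 2))) ≤
      1 - 2 * Real.cos α + Real.cos (2 * α - s - t) := by
  set p := min s (Real.pi / 2) with hp
  set q := min t (Real.pi / 2) with hq
  have hps : p ≤ s := min_le_left _ _
  have hqt : q ≤ t := min_le_left _ _
  have hp0 : 0 < p := lt_min hs (by linarith)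
  have hq0 : 0 < q := lt_min ht (by linarith)
  have hcα : Real.cos α < 0 :=
    Real.cos_neg_of_pi_div_two_lt_of_lt hα₁ (by linarith)
  have hprod : 2 * (Real.sin p * Real.sin q) ≤ 1 - Real.cos (p + q) := by
    have h := Real.cos_le_one (p - q)
    rw [Real.cos_sub] at h
    rw [Real.cos_add]
    linarith
  rcases le_or_gt (2 * α - p - q) Real.pi with h | h
  · have hmono : Real.cos (2 * α - p - q) ≤ Real.cos (2 * α - s - t) :=
      Real.cos_le_cos_of_nonneg_of_le_pi (by linarith) h (by linarith)
    have hsum : Real.cos (2 * α - p - q) + Real.cos (p + q) =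
        2 * (Real.cos α * Real.cos (α - p - q)) := by
      rw [show 2 * α - p - q = α + (α - p - q) by ring,
        show p + q = α - (α - p - q) by ring, Real.cos_add, Real.cos_sub α (α - p - q)]
      ring
    nlinarith [Real.cos_le_one (α - p - q)]
  · have hmono : Real.cos (2 * α - Real.pi) ≤ Real.cos (p + q) :=
      Real.cos_le_cos_of_nonneg_of_le_pi (by linarith) (by linarith) (by linarith)
    rw [Real.cos_sub_pi, Real.cos_two_mul] at hmono
    nlinarith [Real.neg_one_le_cos (2 * α - s - t), Real.neg_one_le_cos α]

lemma sq_dist_add_distBd_le_of_arg_le {θ : ℝ} (h₁ : Real.pi < θ) (h₂ : θ < 2 * Real.pi)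
    {x y z : ℂ} (hx : x ∈ sector θ) (hy : y ∈ sector θ) (hz : z ∉ sector θ) {a b u v : ℝ}
    (ha : 0 < a) (hb : 0 < b) (hv : 0 < v) (hu : u < θ) (hvu : v ≤ u)
    (hxz : x - z = a * Complex.exp (u * Complex.I))
    (hyz : y - z = b * Complex.exp (v * Complex.I)) :
    dist x y ^ 2 + 4 * distBd (sector θ) x * distBd (sector θ) y ≤
      (1 - Real.cos (θ / 2)) * (dist x z + dist z y) ^ 2 := by
  have hdx := distBd_sector_le_sin_sub h₁ h₂ hx hz ha hu hxz
  have hdy := distBd_sector_le_sin h₁ h₂ hy hz hb hv hyz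
  have htrig := two_mul_sin_min_mul_sin_min_le (α := θ / 2) (s := θ - u) (t := v)
    (by linarith) (by linarith) (by linarith) hv (by linarith)
  rw [show 2 * (θ / 2) - (θ - u) - v = u - v by ring] at htrig
  have hdist : dist x y ^ 2 = a ^ 2 + b ^ 2 - 2 * (a * b) * Real.cos (u - v) := by
    rw [← sq_norm_mul_exp_sub, ← hxz, ← hyz, dist_eq_norm, sub_sub_sub_cancel_right]
  have hxz' : dist x z = a := by
    rw [dist_eq_norm, hxz, norm_mul, norm_exp_ofReal_mul_I, mul_one, norm_real,
      Real.norm_of_nonneg ha.le]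
  have hzy' : dist z y = b := by
    rw [dist_comm, dist_eq_norm, hyz, norm_mul, norm_exp_ofReal_mul_I, mul_one, norm_real,
      Real.norm_of_nonneg hb.le]
  have hc : Real.cos (θ / 2) < 0 :=
    Real.cos_neg_of_pi_div_two_lt_of_lt (by linarith) (by linarith)
  have hprod : distBd (sector θ) x * distBd (sector θ) y ≤
      (a * Real.sin (min (θ - u) (Real.pi / 2))) * (b * Real.sin (min v (Real.pi / 2))) :=
    mul_le_mul hdx hdy infDist_nonneg (infDist_nonneg.trans hdx)
  have hscaled := mul_le_mul_of_nonneg_left htrig (mul_pos ha hb).le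
  rw [hdist, hxz', hzy']
  nlinarith [mul_nonneg (neg_nonneg.mpr hc.le) (sq_nonneg (a - b))]

lemma sq_dist_add_distBd_le {θ : ℝ} (h₁ : Real.pi < θ) (h₂ : θ < 2 * Real.pi)
    {x y z : ℂ} (hx : x ∈ sector θ) (hy : y ∈ sector θ) (hz : z ∉ sector θ) :
    dist x y ^ 2 + 4 * distBd (sector θ) x * distBd (sector θ) y ≤
      (1 - Real.cos (θ / 2)) * (dist x z + dist z y) ^ 2 := by
  have hsub : ∀ w ∈ sector θ, w - z ∈ sector θ := fun w hw => by
    by_contra h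
    exact add_notMem_sector h₁ h₂ h hz (by rwa [sub_add_cancel])
  obtain ⟨a, u, ha, hu0, hu, hxz⟩ := hsub x hx
  obtain ⟨b, v, hb, hv0, hv, hyz⟩ := hsub y hy
  rcases le_total v u with h | h
  · exact sq_dist_add_distBd_le_of_arg_le h₁ h₂ hx hy hz ha hb hv0 hu h hxz hyz
  · have key := sq_dist_add_distBd_le_of_arg_le h₁ h₂ hy hx hz hb ha hu0 hv h hyz hxz
    rw [dist_comm y x, dist_comm y z, dist_comm z x] at key
    linarith

theorem stmt_7 (θ : ℝ) (hθ : Real.pi < θ ∧ θ < 2 * Real.pi) :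
    ∀ x ∈ sector θ, ∀ y ∈ sector θ,
      triRatio (sector θ) x y ≤
        Real.sqrt 2 * Real.sin (θ / 4) * pointPair (sector θ) x y := by
  obtain ⟨h₁, h₂⟩ := hθ
  intro x hx y hy
  unfold triRatio pointPair
  rcases eq_or_ne x y with rfl | hxy
  · simp
  have hD : 0 < dist x y := dist_pos.mpr hxy
  set K := Real.sqrt 2 * Real.sin (θ / 4) with hK
  have hKpos : 0 < K := mul_pos (by positivity)
    (Real.sin_pos_of_pos_of_lt_pi (by linarith [Real.pi_pos]) (by linarith [Real.pi_pos]))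
  have hKsq : K ^ 2 = 1 - Real.cos (θ / 2) := by
    rw [hK, mul_pow, Real.sq_sqrt (by norm_num), show θ / 2 = 2 * (θ / 4) by ring,
      Real.cos_two_mul, Real.sin_sq]
    ring
  set Q := dist x y ^ 2 + 4 * distBd (sector θ) x * distBd (sector θ) y with hQ
  have hQpos : 0 < Q := by
    have hdx : 0 ≤ distBd (sector θ) x := infDist_nonneg
    have hdy : 0 ≤ distBd (sector θ) y := infDist_nonneg
    positivity
  have hfrontier : (frontier (sector θ)).Nonempty := by
    obtain ⟨w, hw, -⟩ := exists_mem_frontier_infDist_compl_eq_dist hx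
      (fun h => ofReal_notMem_sector h₁ h₂ le_rfl (h ▸ mem_univ _))
    exact ⟨w, hw⟩
  have hinf : Real.sqrt Q / K ≤
      sInf ((fun z => dist x z + dist z y) '' frontier (sector θ)) := by
    refine le_csInf (hfrontier.image _) ?_
    rintro _ ⟨z, hz, rfl⟩
    have hzS : z ∉ sector θ := by
      rw [(isOpen_sector h₁ h₂).frontier_eq] at hz
      exact hz.2
    rw [div_le_iff₀ hKpos]
    refine Real.sqrt_le_iff.mpr ⟨by positivity, ?_⟩
    rw [mul_pow, hKsq, mul_comm]
    exact sq_dist_add_distBd_le h₁ h₂ hx hy hzS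
  have hsqrt : 0 < Real.sqrt Q := Real.sqrt_pos.mpr hQpos
  calc dist x y / sInf ((fun z => dist x z + dist z y) '' frontier (sector θ))
      ≤ dist x y / (Real.sqrt Q / K) :=
        div_le_div_of_nonneg_left hD.le (div_pos hsqrt hKpos) hinf
    _ = K * (dist x y / Real.sqrt Q) := by field_simp
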